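/- arXiv:0808.0097 — 2 statements merged into one kernel-verified Lean document; each statement's English description precedes it below -/
import Mathlib

section
/- Let R, S ∈ ℝ[X] be nonzero coprime polynomials and a < b in ℝ. Then Ind_a^b((R'·S − R·S')/(R·S)) = (#{x ∈ (a,b) : R(x) = 0} − #{x ∈ (a,b) : S(x) = 0}) + ½·(#{x ∈ {a,b} : R(x) = 0} − #{x ∈ {a,b} : S(x) = 0}); that is, the Cauchy index of the logarithmic derivative of f = R/S on [a,b] equals the number of zeros of f minus the number of poles of f in [a,b], each counted without multiplicity, zeros and poles at the endpoints counting one half. -/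
open Polynomial

/-- The value at `x` of the "unit part" of `P` after removing the factor `(X - x)^m`,
where `m` is the multiplicity of `x` as a root of `P`. Nonzero whenever `P ≠ 0`. -/
noncomputable def unitEval (P : Polynomial ℝ) (x : ℝ) : ℝ :=
  (P /ₘ (X - C x) ^ rootMultiplicity x P).eval x

/-- One-sided Cauchy index `Ind_x^+` of the rational function `R/S` at `x`. -/
noncomputable def indPlus (R S : Polynomial ℝ) (x : ℝ) : ℝ :=
  if (rootMultiplicity x R : ℤ) < (rootMultiplicity x S : ℤ) then
    (1 / 2) * Real.sign (unitEval R x * unitEval S x)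
  else 0

/-- One-sided Cauchy index `Ind_x^-` of the rational function `R/S` at `x`. -/
noncomputable def indMinus (R S : Polynomial ℝ) (x : ℝ) : ℝ :=
  if (rootMultiplicity x R : ℤ) < (rootMultiplicity x S : ℤ) then
    (1 / 2) * (-1 : ℝ) ^ (rootMultiplicity x S - rootMultiplicity x R) *
      Real.sign (unitEval R x * unitEval S x)
  else 0

/-- Local Cauchy index `Ind_x(R/S) = Ind_x^+(R/S) - Ind_x^-(R/S)`. -/
noncomputable def indPoint (R S : Polynomial ℝ) (x : ℝ) : ℝ :=
  indPlus R S x - indMinus R S x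

/-- The Cauchy index `Ind_a^b(R/S)` of the rational function `R/S` on `[a, b]`:
`Ind_a^+(R/S) + Σ_{x ∈ (a,b)} Ind_x(R/S) - Ind_b^-(R/S)`, with the convention that
it is `0` when `R = 0` or `S = 0`.  (Only poles, i.e. roots of `S`, contribute to
the middle sum.) -/
noncomputable def cauchyIndex (R S : Polynomial ℝ) (a b : ℝ) : ℝ :=
  if R = 0 ∨ S = 0 then 0
  else indPlus R S a +
      (∑ x ∈ S.roots.toFinset, if a < x ∧ x < b then indPoint R S x else 0) -
      indMinus R S b

/-- Number of sign changes `V(s_0, …, s_n) = Σ ½|sign s_{k-1} - sign s_k|` of a list of reals. -/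
noncomputable def signVar : List ℝ → ℝ
  | [] => 0
  | [_] => 0
  | a :: b :: l => (1 / 2) * |Real.sign a - Real.sign b| + signVar (b :: l)

/-- Sign changes `V_x(S_0, …, S_n)` of a list of real polynomials evaluated at `x`. -/
noncomputable def signVarAt (L : List (Polynomial ℝ)) (x : ℝ) : ℝ :=
  signVar (L.map fun P => P.eval x)

theorem rootMultiplicity_X_sub_C_pow_mul {u : Polynomial ℝ} {x : ℝ} (m : ℕ)
    (hu : u.eval x ≠ 0) : rootMultiplicity x ((X - C x) ^ m * u) = m := by
  have hu0 : u ≠ 0 := by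
    rintro rfl
    simp at hu
  rw [rootMultiplicity_mul (mul_ne_zero (pow_ne_zero _ (X_sub_C_ne_zero x)) hu0),
    rootMultiplicity_X_sub_C_pow, rootMultiplicity_eq_zero hu, add_zero]

theorem unitEval_X_sub_C_pow_mul {u : Polynomial ℝ} {x : ℝ} (m : ℕ)
    (hu : u.eval x ≠ 0) : unitEval ((X - C x) ^ m * u) x = u.eval x := by
  rw [unitEval, rootMultiplicity_X_sub_C_pow_mul m hu,
    mul_divByMonic_cancel_left _ ((monic_X_sub_C x).pow m)]

theorem indPlus_zero_left (Q : Polynomial ℝ) (x : ℝ) : indPlus 0 Q x = 0 := by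
  simp [indPlus, unitEval]

theorem indMinus_zero_left (Q : Polynomial ℝ) (x : ℝ) : indMinus 0 Q x = 0 := by
  simp [indMinus, unitEval]

theorem indPlus_eq_zero_of_eval_ne_zero (P : Polynomial ℝ) {Q : Polynomial ℝ} {x : ℝ}
    (hQ : Q.eval x ≠ 0) : indPlus P Q x = 0 := by
  simp [indPlus, rootMultiplicity_eq_zero hQ]

theorem indMinus_eq_zero_of_eval_ne_zero (P : Polynomial ℝ) {Q : Polynomial ℝ} {x : ℝ}
    (hQ : Q.eval x ≠ 0) : indMinus P Q x = 0 := by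
  simp [indMinus, rootMultiplicity_eq_zero hQ]

theorem cauchyIndex_of_right_ne_zero (P : Polynomial ℝ) {Q : Polynomial ℝ} (hQ : Q ≠ 0)
    (a b : ℝ) : cauchyIndex P Q a b = indPlus P Q a +
      (∑ x ∈ Q.roots.toFinset, if a < x ∧ x < b then indPoint P Q x else 0) -
      indMinus P Q b := by
  by_cases hP : P = 0
  · simp [cauchyIndex, hP, indPoint, indPlus_zero_left, indMinus_zero_left]
  · simp [cauchyIndex, hP, hQ]

/-- At a zero of `P` which is not a zero of `Q`, the quotient `c (P'Q - PQ') / (PQ)` has a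
simple pole whose residue has the sign of `c`. -/
theorem indPlus_indMinus_logDeriv_of_root {P Q : Polynomial ℝ} {x c : ℝ} (hP : P ≠ 0)
    (hPx : P.eval x = 0) (hQx : Q.eval x ≠ 0) (hc : c ≠ 0) :
    indPlus (C c * (P.derivative * Q - P * Q.derivative)) (P * Q) x =
        (1 / 2) * Real.sign c ∧
      indMinus (C c * (P.derivative * Q - P * Q.derivative)) (P * Q) x =
        -((1 / 2) * Real.sign c) := by
  obtain ⟨u, hu, hux⟩ := exists_eq_pow_rootMultiplicity_mul_and_not_dvd P hP x
  obtain ⟨k, hk⟩ := Nat.exists_eq_succ_of_ne_zero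
    ((rootMultiplicity_pos hP).2 hPx).ne'
  rw [hk, Nat.succ_eq_add_one] at hu
  rw [dvd_iff_isRoot, IsRoot.def] at hux
  have hden : P * Q = (X - C x) ^ (k + 1) * (u * Q) := by rw [hu]; ring
  have hnum : C c * (P.derivative * Q - P * Q.derivative) = (X - C x) ^ k *
      (C c * (C ((k : ℝ) + 1) * u * Q +
        (X - C x) * (u.derivative * Q - u * Q.derivative))) := by
    rw [hu]
    simp only [derivative_mul, derivative_X_sub_C_pow, Nat.add_sub_cancel, C_add, C_1,
      Nat.cast_add, Nat.cast_one, map_natCast]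
    ring
  have hk1 : (0 : ℝ) < (k : ℝ) + 1 := by positivity
  have hdx : (u * Q).eval x ≠ 0 := by simp [hux, hQx]
  have hnv : (C c * (C ((k : ℝ) + 1) * u * Q +
      (X - C x) * (u.derivative * Q - u * Q.derivative))).eval x =
      c * (((k : ℝ) + 1) * u.eval x * Q.eval x) := by simp
  have hnx : (C c * (C ((k : ℝ) + 1) * u * Q +
      (X - C x) * (u.derivative * Q - u * Q.derivative))).eval x ≠ 0 := by
    rw [hnv]
    exact mul_ne_zero hc (mul_ne_zero (mul_ne_zero hk1.ne' hux) hQx)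
  have hsign : Real.sign (c * (((k : ℝ) + 1) * u.eval x * Q.eval x) *
      (u.eval x * Q.eval x)) = Real.sign c := by
    have hpos : 0 < ((k : ℝ) + 1) * (u.eval x * Q.eval x) ^ 2 := by
      have := mul_ne_zero hux hQx
      positivity
    rw [show c * (((k : ℝ) + 1) * u.eval x * Q.eval x) * (u.eval x * Q.eval x) =
      (((k : ℝ) + 1) * (u.eval x * Q.eval x) ^ 2) * c by ring]
    rcases hc.lt_or_gt with h | h
    · rw [Real.sign_of_neg h, Real.sign_of_neg (mul_neg_of_pos_of_neg hpos h)]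
    · rw [Real.sign_of_pos h, Real.sign_of_pos (mul_pos hpos h)]
  rw [hnum, hden, indPlus, indMinus, rootMultiplicity_X_sub_C_pow_mul k hnx,
    rootMultiplicity_X_sub_C_pow_mul (k + 1) hdx, unitEval_X_sub_C_pow_mul k hnx,
    unitEval_X_sub_C_pow_mul (k + 1) hdx, hnv, eval_mul, hsign]
  simp

theorem indPlus_indMinus_logDeriv {R S : Polynomial ℝ} (hR : R ≠ 0) (hS : S ≠ 0)
    (hcop : IsCoprime R S) (x : ℝ) :
    indPlus (R.derivative * S - R * S.derivative) (R * S) x =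
        (1 / 2) * ((if R.eval x = 0 then (1 : ℝ) else 0) -
          (if S.eval x = 0 then (1 : ℝ) else 0)) ∧
      indMinus (R.derivative * S - R * S.derivative) (R * S) x =
        -((1 / 2) * ((if R.eval x = 0 then (1 : ℝ) else 0) -
          (if S.eval x = 0 then (1 : ℝ) else 0))) := by
  by_cases hRx : R.eval x = 0
  · have hSx : S.eval x ≠ 0 := by
      intro hSx
      obtain ⟨p, q, hpq⟩ := hcop
      simpa [hRx, hSx] using congrArg (eval x) hpq
    simpa [hRx, hSx] using
      indPlus_indMinus_logDeriv_of_root hR hRx hSx (one_ne_zero (α := ℝ))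
  · by_cases hSx : S.eval x = 0
    · have h := indPlus_indMinus_logDeriv_of_root hS hSx hRx
        (neg_ne_zero.2 (one_ne_zero (α := ℝ)))
      rw [show C (-1 : ℝ) * (S.derivative * R - S * R.derivative) =
        R.derivative * S - R * S.derivative by rw [C_neg, C_1]; ring, mul_comm S R] at h
      simpa [hRx, hSx, Real.sign_neg] using h
    · have hRS : (R * S).eval x ≠ 0 := by simp [hRx, hSx]
      simp [hRx, hSx, indPlus_eq_zero_of_eval_ne_zero _ hRS,
        indMinus_eq_zero_of_eval_ne_zero _ hRS]

theorem sum_ite_eval_eq_zero {P : Polynomial ℝ} (hP : P ≠ 0) {s : Finset ℝ}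
    (hs : P.roots.toFinset ⊆ s) (p : ℝ → Prop) [DecidablePred p] :
    (∑ x ∈ s, if p x then (if P.eval x = 0 then (1 : ℝ) else 0) else 0) =
      ((P.roots.toFinset.filter p).card : ℝ) := by
  rw [← Finset.sum_subset hs, Finset.card_filter, Nat.cast_sum]
  · refine Finset.sum_congr rfl fun x hx => ?_
    have hx0 : P.eval x = 0 := (mem_roots hP).1 (Multiset.mem_toFinset.1 hx)
    simp [hx0]
  · intro x _ hx
    have hx0 : P.eval x ≠ 0 := fun h => hx (Multiset.mem_toFinset.2 ((mem_roots hP).2 h))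
    simp [hx0]

/-- The Cauchy index of the logarithmic derivative `(R'S - RS')/(RS)` of `f = R/S` on
`[a,b]` equals the number of zeros of `f` minus the number of poles of `f` in `[a,b]`,
each counted without multiplicity, zeros and poles at the endpoints counting one half. -/
theorem cauchyIndex_logDeriv (R S : Polynomial ℝ) (hR : R ≠ 0) (hS : S ≠ 0)
    (hcop : IsCoprime R S) (a b : ℝ) (hab : a < b) :
    cauchyIndex (R.derivative * S - R * S.derivative) (R * S) a b =
      (((R.roots.toFinset.filter fun x => a < x ∧ x < b).card : ℝ) -
        ((S.roots.toFinset.filter fun x => a < x ∧ x < b).card : ℝ)) +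
      (1 / 2) *
        ((((if R.eval a = 0 then (1 : ℝ) else 0) + (if R.eval b = 0 then (1 : ℝ) else 0)) -
          ((if S.eval a = 0 then (1 : ℝ) else 0) + (if S.eval b = 0 then (1 : ℝ) else 0)))) := by
  have hRS : R * S ≠ 0 := mul_ne_zero hR hS
  have hplus := fun x => (indPlus_indMinus_logDeriv hR hS hcop x).1
  have hminus := fun x => (indPlus_indMinus_logDeriv hR hS hcop x).2
  have hsum : (∑ x ∈ (R * S).roots.toFinset, if a < x ∧ x < b then
      indPoint (R.derivative * S - R * S.derivative) (R * S) x else 0) =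
      ((R.roots.toFinset.filter fun x => a < x ∧ x < b).card : ℝ) -
        ((S.roots.toFinset.filter fun x => a < x ∧ x < b).card : ℝ) := by
    have hRsub : R.roots.toFinset ⊆ (R * S).roots.toFinset := by
      rw [roots_mul hRS, Multiset.toFinset_add]
      exact Finset.subset_union_left
    have hSsub : S.roots.toFinset ⊆ (R * S).roots.toFinset := by
      rw [roots_mul hRS, Multiset.toFinset_add]
      exact Finset.subset_union_right
    rw [← sum_ite_eval_eq_zero hR hRsub, ← sum_ite_eval_eq_zero hS hSsub,
      ← Finset.sum_sub_distrib]
    refine Finset.sum_congr rfl fun x _ => ?_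
    by_cases hx : a < x ∧ x < b
    · rw [if_pos hx, if_pos hx, if_pos hx, indPoint, hplus, hminus]
      ring
    · rw [if_neg hx, if_neg hx, if_neg hx, sub_zero]
  rw [cauchyIndex_of_right_ne_zero _ hRS, hsum, hplus, hminus]
  ring
end

section
/- Let (S_0, S_1, …, S_n) be a Sturm chain in ℝ[X] on the interval [a,b], where a < b. Then Ind_a^b(S_1/S_0) + Ind_a^b(S_{n−1}/S_n) = V_a^b(S_0, S_1, …, S_n). -/
open Polynomial

/-- `(S 0, …, S n)` is a Sturm chain on `[a, b]`: for `n ≥ 2`, whenever `S k` vanishes at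
some `x ∈ [a,b]` with `0 < k < n`, its neighbours have opposite signs there; for `n = 1`
the condition is that `S 0` and `S 1` have no common zero in `[a, b]`. -/
def IsSturmChain (S : ℕ → Polynomial ℝ) (n : ℕ) (a b : ℝ) : Prop :=
  (∀ k, 0 < k → k < n → ∀ x ∈ Set.Icc a b, (S k).eval x = 0 →
      (S (k - 1)).eval x * (S (k + 1)).eval x < 0) ∧
  (n = 1 → ∀ x ∈ Set.Icc a b, ¬((S 0).eval x = 0 ∧ (S 1).eval x = 0))

lemma unitEval_ne_zero {P : Polynomial ℝ} (hP : P ≠ 0) (x : ℝ) : unitEval P x ≠ 0 :=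
  eval_divByMonic_pow_rootMultiplicity_ne_zero x hP

lemma unitEval_of_eval_ne_zero {P : Polynomial ℝ} {x : ℝ} (h : P.eval x ≠ 0) :
    unitEval P x = P.eval x := by
  simp [unitEval, rootMultiplicity_eq_zero (p := P) (x := x) h]

lemma eval_eq_pow_mul_eval_divByMonic (P : Polynomial ℝ) (x y : ℝ) :
    P.eval y = (y - x) ^ rootMultiplicity x P *
      (P /ₘ (X - C x) ^ rootMultiplicity x P).eval y := by
  conv_lhs => rw [← pow_mul_divByMonic_rootMultiplicity_eq P x]
  simp

lemma unitEval_mul {P Q : Polynomial ℝ} (h : P * Q ≠ 0) (x : ℝ) :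
    unitEval (P * Q) x = unitEval P x * unitEval Q x := by
  unfold unitEval
  rw [← eval_mul]
  congr 1
  have hm : ((X - C x) ^ rootMultiplicity x (P * Q)) ≠ 0 := pow_ne_zero _ (X_sub_C_ne_zero x)
  apply mul_left_cancel₀ hm
  rw [pow_mul_divByMonic_rootMultiplicity_eq, rootMultiplicity_mul h, pow_add,
    mul_mul_mul_comm, pow_mul_divByMonic_rootMultiplicity_eq,
    pow_mul_divByMonic_rootMultiplicity_eq]

lemma real_sign_mul (x y : ℝ) : Real.sign (x * y) = Real.sign x * Real.sign y := by
  rcases lt_trichotomy x 0 with hx | rfl | hx <;> rcases lt_trichotomy y 0 with hy | rfl | hy <;>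
    simp [Real.sign_of_neg, Real.sign_of_pos, mul_pos_of_neg_of_neg,
      mul_neg_of_pos_of_neg, mul_neg_of_neg_of_pos, *]

/-- The sign of `F` immediately to the right of `x`. -/
noncomputable def signRight (F : Polynomial ℝ) (x : ℝ) : ℝ := Real.sign (unitEval F x)

/-- The sign of `F` immediately to the left of `x`. -/
noncomputable def signLeft (F : Polynomial ℝ) (x : ℝ) : ℝ :=
  (-1) ^ rootMultiplicity x F * Real.sign (unitEval F x)

lemma sign_eval_eq_of_no_roots {U : Polynomial ℝ} {x y : ℝ} (hxy : x ≤ y)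
    (h : ∀ z ∈ Set.Icc x y, U.eval z ≠ 0) :
    Real.sign (U.eval x) = Real.sign (U.eval y) := by
  have hx := h x ⟨le_rfl, hxy⟩
  have hy := h y ⟨hxy, le_rfl⟩
  have hc : ContinuousOn (fun z => U.eval z) (Set.Icc x y) := U.continuous.continuousOn
  rcases lt_or_gt_of_ne hx with hx | hx <;> rcases lt_or_gt_of_ne hy with hy | hy
  · rw [Real.sign_of_neg hx, Real.sign_of_neg hy]
  · obtain ⟨z, hz, hz0⟩ := intermediate_value_Icc hxy hc ⟨hx.le, hy.le⟩
    exact absurd hz0 (h z hz)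
  · obtain ⟨z, hz, hz0⟩ := intermediate_value_Icc' hxy hc ⟨hy.le, hx.le⟩
    exact absurd hz0 (h z hz)
  · rw [Real.sign_of_pos hx, Real.sign_of_pos hy]

lemma signRight_eq_sign_eval {F : Polynomial ℝ} (hF : F ≠ 0) {x y : ℝ} (hxy : x < y)
    (h : ∀ z ∈ Set.Ioc x y, F.eval z ≠ 0) : signRight F x = Real.sign (F.eval y) := by
  have hU : ∀ z ∈ Set.Icc x y, (F /ₘ (X - C x) ^ rootMultiplicity x F).eval z ≠ 0 := by
    intro z hz
    rcases hz.1.eq_or_lt with rfl | hlt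
    · exact unitEval_ne_zero hF x
    · intro h0
      apply h z ⟨hlt, hz.2⟩
      rw [eval_eq_pow_mul_eval_divByMonic F x z, h0, mul_zero]
  rw [eval_eq_pow_mul_eval_divByMonic F x y, real_sign_mul,
    Real.sign_of_pos (pow_pos (sub_pos.2 hxy) _), one_mul]
  exact sign_eval_eq_of_no_roots hxy.le hU

lemma signLeft_eq_sign_eval {F : Polynomial ℝ} (hF : F ≠ 0) {x y : ℝ} (hyx : y < x)
    (h : ∀ z ∈ Set.Ico y x, F.eval z ≠ 0) : signLeft F x = Real.sign (F.eval y) := by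
  have hU : ∀ z ∈ Set.Icc y x, (F /ₘ (X - C x) ^ rootMultiplicity x F).eval z ≠ 0 := by
    intro z hz
    rcases hz.2.eq_or_lt with rfl | hlt
    · exact unitEval_ne_zero hF z
    · intro h0
      apply h z ⟨hz.1, hlt⟩
      rw [eval_eq_pow_mul_eval_divByMonic F x z, h0, mul_zero]
  have hpow : Real.sign ((y - x) ^ rootMultiplicity x F) = (-1) ^ rootMultiplicity x F := by
    rw [← neg_sub x y, neg_pow, real_sign_mul, Real.sign_of_pos (pow_pos (sub_pos.2 hyx) _),
      mul_one]
    rcases neg_one_pow_eq_or ℝ (rootMultiplicity x F) with h | h <;>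
      simp [h, Real.sign_neg]
  rw [eval_eq_pow_mul_eval_divByMonic F x y, real_sign_mul, hpow,
    sign_eval_eq_of_no_roots hyx.le hU]
  rfl

lemma sum_signRight_sub_signLeft {F : Polynomial ℝ} (hF : F ≠ 0) {a b : ℝ} (hab : a < b) :
    signRight F a + (∑ x ∈ F.roots.toFinset,
      if a < x ∧ x < b then signRight F x - signLeft F x else 0) = signLeft F b := by
  induction hn : (F.roots.toFinset.filter fun x => a < x ∧ x < b).card using
    Nat.strong_induction_on generalizing a b with
  | _ n ih =>
    by_cases hc : ∃ c ∈ F.roots.toFinset, a < c ∧ c < b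
    · obtain ⟨c, hcF, hac, hcb⟩ := hc
      have h1 := ih _ (by
        rw [← hn]
        apply Finset.card_lt_card
        refine Finset.ssubset_iff_of_subset (fun x hx => ?_) |>.2 ⟨c, ?_, ?_⟩
        · simp only [Finset.mem_filter] at hx ⊢
          exact ⟨hx.1, hx.2.1, hx.2.2.trans hcb⟩
        · simp only [Finset.mem_filter]
          exact ⟨hcF, hac, hcb⟩
        · simp) hac rfl
      have h2 := ih _ (by
        rw [← hn]
        apply Finset.card_lt_card
        refine Finset.ssubset_iff_of_subset (fun x hx => ?_) |>.2 ⟨c, ?_, ?_⟩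
        · simp only [Finset.mem_filter] at hx ⊢
          exact ⟨hx.1, hac.trans hx.2.1, hx.2.2⟩
        · simp only [Finset.mem_filter]
          exact ⟨hcF, hac, hcb⟩
        · simp) hcb rfl
      have hsplit : (∑ x ∈ F.roots.toFinset,
            if a < x ∧ x < b then signRight F x - signLeft F x else 0) =
          (∑ x ∈ F.roots.toFinset,
            if a < x ∧ x < c then signRight F x - signLeft F x else 0) +
          (∑ x ∈ F.roots.toFinset, if x = c then signRight F x - signLeft F x else 0) +
          (∑ x ∈ F.roots.toFinset,
            if c < x ∧ x < b then signRight F x - signLeft F x else 0) := by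
        rw [← Finset.sum_add_distrib, ← Finset.sum_add_distrib]
        refine Finset.sum_congr rfl fun x _ => ?_
        rcases lt_trichotomy x c with h | h | h
        · simp [h, h.ne, h.trans hcb, not_lt.2 h.le]
        · simp [h, hac, hcb]
        · simp [h, h.ne', hac.trans h, not_lt.2 h.le]
      rw [Finset.sum_ite_eq_of_mem' _ _ _ hcF] at hsplit
      linarith
    · push Not at hc
      have hroot : ∀ z, a < z → z < b → F.eval z ≠ 0 := fun z h1 h2 h0 =>
        absurd h2 (not_lt.2 (hc z (by simp [hF, h0]) h1))
      rw [Finset.sum_eq_zero fun x hx => if_neg fun h => absurd h.2 (not_lt.2 (hc x hx h.1)),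
        add_zero, signRight_eq_sign_eval hF (left_lt_add_div_two.2 hab)
          fun z hz => hroot z hz.1 (hz.2.trans_lt (add_div_two_lt_right.2 hab)),
        signLeft_eq_sign_eval hF (add_div_two_lt_right.2 hab)
          fun z hz => hroot z ((left_lt_add_div_two.2 hab).trans_le hz.1) hz.2]

lemma indPlus_of_eval_ne_zero {Q : Polynomial ℝ} {x : ℝ} (P : Polynomial ℝ)
    (h : Q.eval x ≠ 0) : indPlus P Q x = 0 := by
  simp [indPlus, rootMultiplicity_eq_zero (p := Q) (x := x) h]

lemma indMinus_of_eval_ne_zero {Q : Polynomial ℝ} {x : ℝ} (P : Polynomial ℝ)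
    (h : Q.eval x ≠ 0) : indMinus P Q x = 0 := by
  simp [indMinus, rootMultiplicity_eq_zero (p := Q) (x := x) h]

lemma indPlus_of_isRoot {P Q : Polynomial ℝ} {x : ℝ} (hQ : Q ≠ 0) (h : Q.eval x = 0)
    (hP : P.eval x ≠ 0) : indPlus P Q x = 1 / 2 * Real.sign (P.eval x * unitEval Q x) := by
  have : 0 < rootMultiplicity x Q := (rootMultiplicity_pos hQ).2 h
  simp [indPlus, rootMultiplicity_eq_zero (p := P) (x := x) hP, this,
    unitEval_of_eval_ne_zero hP]

lemma indMinus_of_isRoot {P Q : Polynomial ℝ} {x : ℝ} (hQ : Q ≠ 0) (h : Q.eval x = 0)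
    (hP : P.eval x ≠ 0) : indMinus P Q x =
      1 / 2 * (-1) ^ rootMultiplicity x Q * Real.sign (P.eval x * unitEval Q x) := by
  have : 0 < rootMultiplicity x Q := (rootMultiplicity_pos hQ).2 h
  simp [indMinus, rootMultiplicity_eq_zero (p := P) (x := x) hP, this,
    unitEval_of_eval_ne_zero hP]

lemma indPlus_add_indPlus_swap {P Q : Polynomial ℝ} {x : ℝ} (hP : P ≠ 0) (hQ : Q ≠ 0)
    (h : ¬(P.eval x = 0 ∧ Q.eval x = 0)) :
    indPlus P Q x + indPlus Q P x =
      1 / 2 * (signRight (P * Q) x - Real.sign ((P * Q).eval x)) := by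
  rw [signRight, unitEval_mul (mul_ne_zero hP hQ), eval_mul]
  by_cases hp : P.eval x = 0
  · have hq : Q.eval x ≠ 0 := fun hq => h ⟨hp, hq⟩
    rw [indPlus_of_eval_ne_zero P hq, indPlus_of_isRoot hP hp hq, unitEval_of_eval_ne_zero hq]
    simp [hp, mul_comm]
  · by_cases hq : Q.eval x = 0
    · rw [indPlus_of_eval_ne_zero Q hp, indPlus_of_isRoot hQ hq hp, unitEval_of_eval_ne_zero hp]
      simp [hq]
    · rw [indPlus_of_eval_ne_zero Q hp, indPlus_of_eval_ne_zero P hq,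
        unitEval_of_eval_ne_zero hp, unitEval_of_eval_ne_zero hq]
      simp

lemma indMinus_add_indMinus_swap {P Q : Polynomial ℝ} {x : ℝ} (hP : P ≠ 0) (hQ : Q ≠ 0)
    (h : ¬(P.eval x = 0 ∧ Q.eval x = 0)) :
    indMinus P Q x + indMinus Q P x =
      1 / 2 * (signLeft (P * Q) x - Real.sign ((P * Q).eval x)) := by
  rw [signLeft, unitEval_mul (mul_ne_zero hP hQ), rootMultiplicity_mul (mul_ne_zero hP hQ),
    eval_mul]
  by_cases hp : P.eval x = 0
  · have hq : Q.eval x ≠ 0 := fun hq => h ⟨hp, hq⟩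
    rw [indMinus_of_eval_ne_zero P hq, indMinus_of_isRoot hP hp hq, unitEval_of_eval_ne_zero hq,
      rootMultiplicity_eq_zero (p := Q) (x := x) hq, mul_comm (Q.eval x)]
    simp [hp, mul_assoc]
  · by_cases hq : Q.eval x = 0
    · rw [indMinus_of_eval_ne_zero Q hp, indMinus_of_isRoot hQ hq hp,
        unitEval_of_eval_ne_zero hp, rootMultiplicity_eq_zero (p := P) (x := x) hp]
      simp [hq, mul_assoc]
    · rw [indMinus_of_eval_ne_zero Q hp, indMinus_of_eval_ne_zero P hq,
        unitEval_of_eval_ne_zero hp, unitEval_of_eval_ne_zero hq,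
        rootMultiplicity_eq_zero (p := Q) (x := x) hq,
        rootMultiplicity_eq_zero (p := P) (x := x) hp]
      simp

lemma cauchyIndex_eq_sum {P Q : Polynomial ℝ} (hP : P ≠ 0) (hQ : Q ≠ 0) {T : Finset ℝ}
    (hT : Q.roots.toFinset ⊆ T) (a b : ℝ) :
    cauchyIndex P Q a b = indPlus P Q a +
      (∑ x ∈ T, if a < x ∧ x < b then indPoint P Q x else 0) - indMinus P Q b := by
  rw [cauchyIndex, if_neg (by simp [hP, hQ]), Finset.sum_subset hT]
  intro x _ hx
  have hx' : Q.eval x ≠ 0 := fun h => hx (by simp [hQ, h])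
  simp [indPoint, indPlus_of_eval_ne_zero P hx', indMinus_of_eval_ne_zero P hx']

lemma half_abs_sign_sub_sign {s t : ℝ} (h : ¬(s = 0 ∧ t = 0)) :
    1 / 2 * |Real.sign s - Real.sign t| = 1 / 2 * (1 - Real.sign (s * t)) := by
  rw [real_sign_mul]
  rcases lt_trichotomy s 0 with hs | rfl | hs <;> rcases lt_trichotomy t 0 with ht | rfl | ht <;>
    first
    | exact absurd ⟨rfl, rfl⟩ h
    | norm_num [Real.sign_of_neg, Real.sign_of_pos, *]

/-- The inversion formula for the Cauchy index. -/
lemma cauchyIndex_add_cauchyIndex_swap {P Q : Polynomial ℝ} {a b : ℝ} (hab : a < b)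
    (h : ∀ x ∈ Set.Icc a b, ¬(P.eval x = 0 ∧ Q.eval x = 0)) :
    cauchyIndex P Q a b + cauchyIndex Q P a b =
      1 / 2 * |Real.sign (P.eval a) - Real.sign (Q.eval a)| -
      1 / 2 * |Real.sign (P.eval b) - Real.sign (Q.eval b)| := by
  have ha := h a ⟨le_rfl, hab.le⟩
  have hb := h b ⟨hab.le, le_rfl⟩
  rw [half_abs_sign_sub_sign ha, half_abs_sign_sub_sign hb]
  by_cases hP : P = 0
  · simp [cauchyIndex, hP]
  by_cases hQ : Q = 0
  · simp [cauchyIndex, hQ]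
  have hPQ : P * Q ≠ 0 := mul_ne_zero hP hQ
  rw [cauchyIndex_eq_sum (T := (P * Q).roots.toFinset) hP hQ
      (by rw [roots_mul hPQ, Multiset.toFinset_add]; exact Finset.subset_union_right),
    cauchyIndex_eq_sum (T := (P * Q).roots.toFinset) hQ hP
      (by rw [roots_mul hPQ, Multiset.toFinset_add]; exact Finset.subset_union_left)]
  have hsum : (∑ x ∈ (P * Q).roots.toFinset, if a < x ∧ x < b then indPoint P Q x else 0) +
      (∑ x ∈ (P * Q).roots.toFinset, if a < x ∧ x < b then indPoint Q P x else 0) =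
      1 / 2 * ∑ x ∈ (P * Q).roots.toFinset,
        if a < x ∧ x < b then signRight (P * Q) x - signLeft (P * Q) x else 0 := by
    rw [← Finset.sum_add_distrib, Finset.mul_sum]
    refine Finset.sum_congr rfl fun x _ => ?_
    split_ifs with hx
    · have hx' := h x ⟨hx.1.le, hx.2.le⟩
      have h1 := indPlus_add_indPlus_swap hP hQ hx'
      have h2 := indMinus_add_indMinus_swap hP hQ hx'
      simp only [indPoint]
      linarith
    · simp
  have h1 := indPlus_add_indPlus_swap hP hQ ha
  have h2 := indMinus_add_indMinus_swap hP hQ hb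
  have h3 := sum_signRight_sub_signLeft hPQ hab
  rw [eval_mul] at h1 h2
  linarith

lemma cauchyIndex_add_cauchyIndex_eq_zero {A B Q : Polynomial ℝ} {a b : ℝ} (hab : a < b)
    (h : ∀ x ∈ Set.Icc a b, Q.eval x = 0 → A.eval x * B.eval x < 0) :
    cauchyIndex A Q a b + cauchyIndex B Q a b = 0 := by
  by_cases hQ : Q = 0
  · simp [cauchyIndex, hQ]
  have key : ∀ x ∈ Set.Icc a b, indPlus A Q x + indPlus B Q x = 0 ∧
      indMinus A Q x + indMinus B Q x = 0 := by
    intro x hx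
    by_cases hq : Q.eval x = 0
    · have hAB := h x hx hq
      have hA : A.eval x ≠ 0 := left_ne_zero_of_mul hAB.ne
      have hB : B.eval x ≠ 0 := right_ne_zero_of_mul hAB.ne
      have hs : Real.sign (A.eval x) = -Real.sign (B.eval x) := by
        rcases mul_neg_iff.1 hAB with ⟨h1, h2⟩ | ⟨h1, h2⟩ <;>
          simp [Real.sign_of_neg, Real.sign_of_pos, h1, h2]
      rw [indPlus_of_isRoot hQ hq hA, indPlus_of_isRoot hQ hq hB, indMinus_of_isRoot hQ hq hA,
        indMinus_of_isRoot hQ hq hB]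
      simp only [real_sign_mul, hs]
      constructor <;> ring
    · simp [indPlus_of_eval_ne_zero _ hq, indMinus_of_eval_ne_zero _ hq]
  have formula : ∀ P : Polynomial ℝ, (P = 0 → ∀ x ∈ Set.Icc a b, Q.eval x ≠ 0) →
      cauchyIndex P Q a b = indPlus P Q a +
        (∑ x ∈ Q.roots.toFinset, if a < x ∧ x < b then indPoint P Q x else 0) -
          indMinus P Q b := by
    intro P hP
    by_cases h0 : P = 0
    · have hq := hP h0
      rw [indPlus_of_eval_ne_zero P (hq a ⟨le_rfl, hab.le⟩),
        indMinus_of_eval_ne_zero P (hq b ⟨hab.le, le_rfl⟩), Finset.sum_eq_zero]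
      · simp [cauchyIndex, h0]
      · intro x _
        split_ifs with hx
        · have hx' := hq x ⟨hx.1.le, hx.2.le⟩
          simp [indPoint, indPlus_of_eval_ne_zero P hx', indMinus_of_eval_ne_zero P hx']
        · rfl
    · exact cauchyIndex_eq_sum h0 hQ subset_rfl a b
  rw [formula A fun h0 x hx hq => by simpa [h0] using h x hx hq,
    formula B fun h0 x hx hq => by simpa [h0] using h x hx hq]
  have hsum : (∑ x ∈ Q.roots.toFinset, if a < x ∧ x < b then indPoint A Q x else 0) +
      (∑ x ∈ Q.roots.toFinset, if a < x ∧ x < b then indPoint B Q x else 0) = 0 := by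
    rw [← Finset.sum_add_distrib]
    refine Finset.sum_eq_zero fun x _ => ?_
    split_ifs with hx
    · have := key x ⟨hx.1.le, hx.2.le⟩
      simp only [indPoint]
      linarith
    · simp
  have h1 := (key a ⟨le_rfl, hab.le⟩).1
  have h2 := (key b ⟨hab.le, le_rfl⟩).2
  linarith

lemma signVar_map_range (f : ℕ → ℝ) (n : ℕ) :
    signVar ((List.range (n + 1)).map f) =
      ∑ k ∈ Finset.range n, 1 / 2 * |Real.sign (f k) - Real.sign (f (k + 1))| := by
  induction n generalizing f with
  | zero => simp [signVar]
  | succ n ih =>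
    rw [Finset.sum_range_succ', ← ih fun k => f (k + 1)]
    simp only [List.range_succ_eq_map, List.map_cons, List.map_map, signVar]
    rw [add_comm]
    rfl

lemma signVarAt_map_range (S : ℕ → Polynomial ℝ) (n : ℕ) (x : ℝ) :
    signVarAt ((List.range (n + 1)).map S) x =
      ∑ k ∈ Finset.range n,
        1 / 2 * |Real.sign ((S k).eval x) - Real.sign ((S (k + 1)).eval x)| := by
  rw [signVarAt, List.map_map, signVar_map_range]
  rfl

lemma IsSturmChain.no_common_zero {S : ℕ → Polynomial ℝ} {n : ℕ} {a b : ℝ}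
    (hS : IsSturmChain S n a b) {k : ℕ} (hk : k < n) {x : ℝ} (hx : x ∈ Set.Icc a b) :
    ¬((S k).eval x = 0 ∧ (S (k + 1)).eval x = 0) := by
  rintro ⟨h0, h1⟩
  rcases Nat.eq_zero_or_pos k with rfl | hpos
  · rcases Nat.lt_or_ge 1 n with hn | hn
    · simpa [h0] using hS.1 1 one_pos hn x hx h1
    · exact hS.2 (by omega) x hx ⟨h0, h1⟩
  · simpa [h1] using hS.1 k hpos hk x hx h0

lemma IsSturmChain.sum_cauchyIndex {S : ℕ → Polynomial ℝ} {n : ℕ} {a b : ℝ} (hab : a < b)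
    (hS : IsSturmChain S n a b) {m : ℕ} (hm : m < n) :
    ∑ k ∈ Finset.range (m + 1),
        (cauchyIndex (S k) (S (k + 1)) a b + cauchyIndex (S (k + 1)) (S k) a b) =
      cauchyIndex (S 1) (S 0) a b + cauchyIndex (S m) (S (m + 1)) a b := by
  induction m with
  | zero => simp [add_comm]
  | succ m ih =>
    have h0 := cauchyIndex_add_cauchyIndex_eq_zero hab (hS.1 (m + 1) m.succ_pos hm)
    rw [Nat.add_sub_cancel] at h0
    rw [Finset.sum_range_succ, ih (by omega)]
    linarith

/-- If `(S 0, S 1, …, S n)` is a Sturm chain on `[a, b]`, then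
`Ind_a^b(S 1 / S 0) + Ind_a^b(S (n-1) / S n) = V_a^b(S 0, S 1, …, S n)`. -/
theorem cauchyIndex_sturmChain (S : ℕ → Polynomial ℝ) (n : ℕ) (hn : 1 ≤ n)
    (a b : ℝ) (hab : a < b) (hS : IsSturmChain S n a b) :
    cauchyIndex (S 1) (S 0) a b + cauchyIndex (S (n - 1)) (S n) a b =
      signVarAt ((List.range (n + 1)).map S) a -
      signVarAt ((List.range (n + 1)).map S) b := by
  obtain ⟨m, rfl⟩ : ∃ m, n = m + 1 := ⟨n - 1, by omega⟩
  rw [Nat.add_sub_cancel, ← hS.sum_cauchyIndex hab m.lt_succ_self, signVarAt_map_range,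
    signVarAt_map_range, ← Finset.sum_sub_distrib]
  refine Finset.sum_congr rfl fun k hk => ?_
  exact cauchyIndex_add_cauchyIndex_swap hab
    fun x hx => hS.no_common_zero (Finset.mem_range.1 hk) hx
end
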